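/- Let K and N be natural numbers with 2 ≤ K and 1 ≤ N ≤ K. Then both (1 − 1/K)^{N−1} · ((1 − 1/K)^{−0.49} − 1) ≥ 0.49/(e·K) and (1 − 1/K)^{N−1} · (1 − (1 − 1/K)^{0.49}) ≥ 0.49/(e·K) hold, and moreover 0.49/(e·K) ≥ 0.1/K. Here (1 − 1/K)^{N−1} is a natural-number power and (1 − 1/K)^{±0.49} are real (rpow) powers. -/

import Mathlib

theorem exp_neg_one_le_one_sub_inv_pow {K : ℕ} (hK : 2 ≤ K) :
    Real.exp (-1) ≤ (1 - 1 / (K : ℝ)) ^ (K - 1) := by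
  have hK' : (2 : ℝ) ≤ K := by exact_mod_cast hK
  have hpos : (0 : ℝ) < K - 1 := by linarith
  have hbase : Real.exp (-(1 / ((K : ℝ) - 1))) ≤ 1 - 1 / (K : ℝ) := by
    have h := Real.add_one_le_exp (1 / ((K : ℝ) - 1))
    have heq : 1 - 1 / (K : ℝ) = (1 / ((K : ℝ) - 1) + 1)⁻¹ := by
      field_simp
      ring
    rw [heq, Real.exp_neg]
    gcongr
  calc Real.exp (-1) = Real.exp (-(1 / ((K : ℝ) - 1))) ^ (K - 1) := by
        rw [← Real.exp_nat_mul, Nat.cast_sub (by omega)]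
        congr 1
        push_cast
        field_simp
    _ ≤ _ := by gcongr

theorem one_sub_rpow_le_rpow_neg_sub_one {a : ℝ} (ha : 0 < a) (γ : ℝ) :
    1 - a ^ γ ≤ a ^ (-γ) - 1 := by
  have ht : 0 < a ^ γ := Real.rpow_pos_of_pos ha γ
  rw [Real.rpow_neg ha.le]
  have h : (a ^ γ)⁻¹ - 1 - (1 - a ^ γ) = (a ^ γ - 1) ^ 2 / a ^ γ := by
    field_simp
    ring
  have : 0 ≤ (a ^ γ - 1) ^ 2 / a ^ γ := by positivity
  linarith

/-- Lower bound `ε₁ ≥ 0.1/K` on the accuracy required of the empirical collision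
frequency in the player-number estimation: for `2 ≤ K` and `1 ≤ N ≤ K`, both
`(1-1/K)^(N-1) · ((1-1/K)^(-0.49) - 1) ≥ 0.49/(e·K)` and
`(1-1/K)^(N-1) · (1 - (1-1/K)^(0.49)) ≥ 0.49/(e·K)`, and `0.49/(e·K) ≥ 0.1/K`.
Here `(1-1/K)^(N-1)` is a natural-number power and `(1-1/K)^(±0.49)` are real powers. -/
theorem estimator_epsilon_lower_bound (K N : ℕ) (hK : 2 ≤ K) (hN1 : 1 ≤ N) (hNK : N ≤ K) :
    (1 - 1 / (K : ℝ)) ^ (N - 1) * ((1 - 1 / (K : ℝ)) ^ (-(0.49 : ℝ)) - 1) ≥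
        0.49 / (Real.exp 1 * K) ∧
      (1 - 1 / (K : ℝ)) ^ (N - 1) * (1 - (1 - 1 / (K : ℝ)) ^ ((0.49 : ℝ))) ≥
        0.49 / (Real.exp 1 * K) ∧
      0.49 / (Real.exp 1 * K) ≥ 0.1 / (K : ℝ) := by
  have hK' : (2 : ℝ) ≤ K := by exact_mod_cast hK
  have hinv : 1 / (K : ℝ) ≤ 1 / 2 := by gcongr
  have hinv0 : 0 < 1 / (K : ℝ) := by positivity
  have ha : 0 < 1 - 1 / (K : ℝ) := by linarith
  have hpow : Real.exp (-1) ≤ (1 - 1 / (K : ℝ)) ^ (N - 1) :=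
    (exp_neg_one_le_one_sub_inv_pow hK).trans
      (pow_le_pow_of_le_one ha.le (by linarith) (by omega))
  have hrpow : 0.49 * (1 / (K : ℝ)) ≤ 1 - (1 - 1 / (K : ℝ)) ^ (0.49 : ℝ) := by
    have h := rpow_one_add_le_one_add_mul_self (s := -(1 / (K : ℝ))) (p := 0.49)
      (by linarith) (by norm_num) (by norm_num)
    rw [← sub_eq_add_neg] at h
    linarith
  have hmain : 0.49 / (Real.exp 1 * K) ≤
      (1 - 1 / (K : ℝ)) ^ (N - 1) * (1 - (1 - 1 / (K : ℝ)) ^ (0.49 : ℝ)) := by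
    calc 0.49 / (Real.exp 1 * K) = Real.exp (-1) * (0.49 * (1 / (K : ℝ))) := by
          rw [Real.exp_neg]
          field_simp
      _ ≤ _ := by gcongr
  refine ⟨hmain.trans ?_, hmain, ?_⟩
  · exact mul_le_mul_of_nonneg_left (one_sub_rpow_le_rpow_neg_sub_one ha _) (pow_pos ha _).le
  · rw [ge_iff_le, div_le_div_iff₀ (by positivity) (by positivity)]
    nlinarith [Real.exp_one_lt_three]
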